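/- For every c > 0 and every u ≥ 0, ∫_u^∞ [c·φ(x/c) + x·Φ(x/c)]·φ(x) dx ≥ φ(u); equivalently, ∫_u^∞ [c·φ(x/c) − x·Φ̄(x/c)]·φ(x) dx ≥ 0. -/

import Mathlib

open MeasureTheory Real

/-- The standard normal density `φ`. -/
noncomputable def stdGaussianPDF (x : ℝ) : ℝ :=
  (Real.sqrt (2 * Real.pi))⁻¹ * Real.exp (-x ^ 2 / 2)

/-- The standard normal distribution function `Φ`. -/
noncomputable def stdGaussianCDF (x : ℝ) : ℝ :=
  ∫ t in Set.Iic x, stdGaussianPDF t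

/-- The Gaussian tail `Φ̄ = 1 - Φ`. -/
noncomputable def stdGaussianTail (x : ℝ) : ℝ := 1 - stdGaussianCDF x

open Set Filter Topology

theorem stdGaussianPDF_eq_gaussianPDFReal :
    stdGaussianPDF = ProbabilityTheory.gaussianPDFReal 0 1 := by
  funext x
  simp [stdGaussianPDF, ProbabilityTheory.gaussianPDFReal]

theorem stdGaussianPDF_nonneg (x : ℝ) : 0 ≤ stdGaussianPDF x := by
  unfold stdGaussianPDF
  positivity

theorem continuous_stdGaussianPDF : Continuous stdGaussianPDF := by
  unfold stdGaussianPDF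
  fun_prop

theorem integrable_stdGaussianPDF : Integrable stdGaussianPDF := by
  rw [stdGaussianPDF_eq_gaussianPDFReal]
  exact ProbabilityTheory.integrable_gaussianPDFReal 0 1

theorem integral_stdGaussianPDF : ∫ x, stdGaussianPDF x = 1 := by
  rw [stdGaussianPDF_eq_gaussianPDFReal]
  exact ProbabilityTheory.integral_gaussianPDFReal_eq_one 0 one_ne_zero

theorem integrable_id_mul_stdGaussianPDF : Integrable fun x => x * stdGaussianPDF x := by
  have h := (integrable_mul_exp_neg_mul_sq (b := 1 / 2) (by norm_num)).const_mul
    (Real.sqrt (2 * Real.pi))⁻¹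
  refine h.congr (Eventually.of_forall fun x => ?_)
  simp only [stdGaussianPDF]
  ring_nf

theorem hasDerivAt_neg_stdGaussianPDF (x : ℝ) :
    HasDerivAt (fun y => -stdGaussianPDF y) (x * stdGaussianPDF x) x := by
  have h : HasDerivAt (fun y : ℝ => -y ^ 2 / 2) (-x) x := by
    convert! ((hasDerivAt_pow 2 x).neg.div_const 2) using 1
    norm_num
    ring
  convert! (h.exp.const_mul (Real.sqrt (2 * Real.pi))⁻¹).neg using 1
  simp only [stdGaussianPDF]
  ring

theorem tendsto_stdGaussianPDF_atTop : Tendsto stdGaussianPDF atTop (𝓝 0) := by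
  have h : Tendsto (fun x : ℝ => -x ^ 2 / 2) atTop atBot :=
    (tendsto_neg_atTop_atBot.comp (tendsto_pow_atTop two_ne_zero)).atBot_div_const two_pos
  unfold stdGaussianPDF
  simpa only [mul_zero, Function.comp_def] using
    (tendsto_exp_atBot.comp h).const_mul (Real.sqrt (2 * Real.pi))⁻¹

theorem integral_Ioi_id_mul_stdGaussianPDF (u : ℝ) :
    ∫ x in Ioi u, x * stdGaussianPDF x = stdGaussianPDF u := by
  have h := integral_Ioi_of_hasDerivAt_of_tendsto' (a := u) (m := 0)
    (fun x _ => hasDerivAt_neg_stdGaussianPDF x)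
    integrable_id_mul_stdGaussianPDF.integrableOn
    (by simpa using tendsto_stdGaussianPDF_atTop.neg)
  simpa using h

theorem stdGaussianTail_eq_integral_Ioi (x : ℝ) :
    stdGaussianTail x = ∫ t in Ioi x, stdGaussianPDF t := by
  have h := intervalIntegral.integral_Iic_add_Ioi (b := x)
    integrable_stdGaussianPDF.integrableOn integrable_stdGaussianPDF.integrableOn
  rw [integral_stdGaussianPDF] at h
  rw [stdGaussianTail, stdGaussianCDF]
  linarith

/-- The upper Mills ratio bound. -/
theorem mul_stdGaussianTail_le (x : ℝ) : x * stdGaussianTail x ≤ stdGaussianPDF x := by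
  rw [stdGaussianTail_eq_integral_Ioi, ← integral_Ioi_id_mul_stdGaussianPDF x,
    ← integral_const_mul]
  refine setIntegral_mono_on (integrable_stdGaussianPDF.const_mul x).integrableOn
    integrable_id_mul_stdGaussianPDF.integrableOn measurableSet_Ioi fun t ht => ?_
  exact mul_le_mul_of_nonneg_right (le_of_lt ht) (stdGaussianPDF_nonneg t)

theorem stdGaussianCDF_nonneg (x : ℝ) : 0 ≤ stdGaussianCDF x :=
  integral_nonneg stdGaussianPDF_nonneg

theorem stdGaussianTail_nonneg (x : ℝ) : 0 ≤ stdGaussianTail x := by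
  rw [stdGaussianTail_eq_integral_Ioi]
  exact integral_nonneg stdGaussianPDF_nonneg

theorem stdGaussianTail_le_one (x : ℝ) : stdGaussianTail x ≤ 1 :=
  sub_le_self 1 (stdGaussianCDF_nonneg x)

theorem monotone_stdGaussianCDF : Monotone stdGaussianCDF := fun _ _ h =>
  setIntegral_mono_set integrable_stdGaussianPDF.integrableOn
    (Eventually.of_forall stdGaussianPDF_nonneg) (Iic_subset_Iic.2 h).eventuallyLE

theorem measurable_stdGaussianTail : Measurable stdGaussianTail :=
  measurable_const.sub monotone_stdGaussianCDF.measurable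

theorem stdGaussianPDF_le (x : ℝ) : stdGaussianPDF x ≤ (Real.sqrt (2 * Real.pi))⁻¹ :=
  mul_le_of_le_one_right (by positivity) (Real.exp_le_one_iff.2 (by nlinarith [sq_nonneg x]))

theorem integrable_sub_mul_stdGaussianTail (c : ℝ) :
    Integrable fun x =>
      (c * stdGaussianPDF (x / c) - x * stdGaussianTail (x / c)) * stdGaussianPDF x := by
  have h₁ : Integrable fun x => stdGaussianPDF (x / c) * stdGaussianPDF x := by
    refine integrable_stdGaussianPDF.bdd_mul (c := (Real.sqrt (2 * Real.pi))⁻¹)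
      (continuous_stdGaussianPDF.comp (continuous_id.div_const c)).aestronglyMeasurable
      (Eventually.of_forall fun x => ?_)
    rw [Real.norm_of_nonneg (stdGaussianPDF_nonneg _)]
    exact stdGaussianPDF_le _
  have h₂ : Integrable fun x => stdGaussianTail (x / c) * (x * stdGaussianPDF x) := by
    refine integrable_id_mul_stdGaussianPDF.bdd_mul (c := 1)
      (measurable_stdGaussianTail.comp (measurable_id.div_const c)).aestronglyMeasurable
      (Eventually.of_forall fun x => ?_)
    rw [Real.norm_of_nonneg (stdGaussianTail_nonneg _)]
    exact stdGaussianTail_le_one _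
  refine ((h₁.const_mul c).sub h₂).congr (Eventually.of_forall fun x => ?_)
  simp only [Pi.sub_apply]
  ring

/-- For `c > 0` and `u ≥ 0`, `∫_u^∞ [c φ(x/c) + x Φ(x/c)] φ(x) dx ≥ φ(u)`;
equivalently `∫_u^∞ [c φ(x/c) - x Φ̄(x/c)] φ(x) dx ≥ 0`. -/
theorem dim_one_term_comparison (c : ℝ) (hc : 0 < c) (u : ℝ) (hu : 0 ≤ u) :
    (∫ x in Set.Ioi u,
        (c * stdGaussianPDF (x / c) + x * stdGaussianCDF (x / c)) * stdGaussianPDF x) ≥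
      stdGaussianPDF u ∧
    (∫ x in Set.Ioi u,
        (c * stdGaussianPDF (x / c) - x * stdGaussianTail (x / c)) * stdGaussianPDF x) ≥ 0 := by
  have h : 0 ≤ ∫ x in Ioi u,
      (c * stdGaussianPDF (x / c) - x * stdGaussianTail (x / c)) * stdGaussianPDF x := by
    refine integral_nonneg fun x => mul_nonneg ?_ (stdGaussianPDF_nonneg x)
    have hm := mul_le_mul_of_nonneg_left (mul_stdGaussianTail_le (x / c)) hc.le
    rw [← mul_assoc, mul_div_cancel₀ x hc.ne'] at hm
    exact sub_nonneg.2 hm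
  refine ⟨?_, h⟩
  have hsplit : ∀ x, (c * stdGaussianPDF (x / c) + x * stdGaussianCDF (x / c)) * stdGaussianPDF x =
      (c * stdGaussianPDF (x / c) - x * stdGaussianTail (x / c)) * stdGaussianPDF x +
        x * stdGaussianPDF x := fun x => by
    rw [stdGaussianTail]
    ring
  simp only [hsplit]
  rw [integral_add (integrable_sub_mul_stdGaussianTail c).integrableOn
    integrable_id_mul_stdGaussianPDF.integrableOn, integral_Ioi_id_mul_stdGaussianPDF]
  exact le_add_of_nonneg_left h
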